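/- arXiv:1609.00482 — 2 statements merged into one kernel-verified Lean document; each statement's English description precedes it below -/
import Mathlib

section
/- For every α ∈ (0,1) and all density matrices ρ₁, ρ₂ on ℂ^n, one has 0 ≤ F_α(ρ₁, ρ₂) ≤ 1, and F_α(ρ₁, ρ₂) = 1 if and only if ρ₁ = ρ₂. -/
open Matrix
open scoped Kronecker ComplexOrder

/-- Real power of a (Hermitian) matrix, defined by applying the real power function to the
eigenvalues via the spectral decomposition (functional calculus). -/
noncomputable def mpow {ι : Type*} [Fintype ι] [DecidableEq ι]
    (A : Matrix ι ι ℂ) (t : ℝ) : Matrix ι ι ℂ :=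
  if hA : A.IsHermitian then
    (hA.eigenvectorUnitary : Matrix ι ι ℂ) *
      Matrix.diagonal (fun i => ((hA.eigenvalues i ^ t : ℝ) : ℂ)) *
      star (hA.eigenvectorUnitary : Matrix ι ι ℂ)
  else 0

/-- The α-fidelity `F_α(ρ,σ) = tr[(σ^((1−α)/(2α)) ρ σ^((1−α)/(2α)))^α]`. -/
noncomputable def aFid {ι : Type*} [Fintype ι] [DecidableEq ι]
    (α : ℝ) (ρ σ : Matrix ι ι ℂ) : ℝ :=
  (Matrix.trace (mpow (mpow σ ((1 - α) / (2 * α)) * ρ * mpow σ ((1 - α) / (2 * α))) α)).re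

/-- A density matrix: positive semidefinite with trace 1. -/
def IsDensity {ι : Type*} [Fintype ι] (ρ : Matrix ι ι ℂ) : Prop :=
  ρ.PosSemidef ∧ ρ.trace = 1

/-- Partial trace over the second tensor factor. -/
noncomputable def ptrace2 {ι κ : Type*} [Fintype κ]
    (M : Matrix (ι × κ) (ι × κ) ℂ) : Matrix ι ι ℂ :=
  Matrix.of fun i j => ∑ k : κ, M (i, k) (j, k)

/-- A quantum channel: a map admitting a Kraus representation `E(X) = Σ_i K_i X K_i*`
with `Σ_i K_i* K_i = 1`. -/
def IsQChannel {ι κ : Type*} [Fintype ι] [DecidableEq ι] [Fintype κ] [DecidableEq κ]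
    (E : Matrix ι ι ℂ → Matrix κ κ ℂ) : Prop :=
  ∃ (k : ℕ) (K : Fin k → Matrix κ ι ℂ),
    (∀ X, E X = ∑ i, K i * X * (K i)ᴴ) ∧ (∑ i, (K i)ᴴ * K i = 1)

/-- The α-fidelity of channels:
`𝓕_α(E₁,E₂) = inf { F_α(E₁(ρ₁),E₂(ρ₂)) / F_α(ρ₁,ρ₂) }` over density matrices with
`F_α(ρ₁,ρ₂) > 0`. -/
noncomputable def chanFid {ι κ : Type*} [Fintype ι] [DecidableEq ι] [Fintype κ] [DecidableEq κ]
    (α : ℝ) (E₁ E₂ : Matrix ι ι ℂ → Matrix κ κ ℂ) : ℝ :=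
  sInf { r : ℝ | ∃ ρ₁ ρ₂ : Matrix ι ι ℂ, IsDensity ρ₁ ∧ IsDensity ρ₂ ∧
    0 < aFid α ρ₁ ρ₂ ∧ r = aFid α (E₁ ρ₁) (E₂ ρ₂) / aFid α ρ₁ ρ₂ }

/-- Jensen's inequality for `x ↦ x ^ α` combined with the weighted AM-GM inequality. -/
theorem sum_mul_rpow_le {ι : Type*} [Fintype ι] {α q r s : ℝ} (hα : 0 < α) (hα' : α < 1)
    (hq : α * (2 * q) = 1 - α) {p x : ι → ℝ} (hp : ∀ i, 0 ≤ p i) (hp1 : ∑ i, p i = 1)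
    (hx : ∀ i, 0 ≤ x i) (hr : 0 ≤ r) (hs : 0 ≤ s)
    (hsum : ∑ i, p i * x i = s ^ q * r * s ^ q) :
    ∑ i, p i * x i ^ α ≤ α * r + (1 - α) * s ∧
      (∑ i, p i * x i ^ α = α * r + (1 - α) * s →
        r = s ∧ ∀ i, p i ≠ 0 → x i = s ^ q * s * s ^ q) := by
  have hc := Real.strictConcaveOn_rpow hα hα'
  have jensen := hc.concaveOn.le_map_sum (t := Finset.univ) (fun i _ => hp i) hp1
    (fun i _ => hx i)
  have jensen_eq := hc.map_sum_eq_iff' (t := Finset.univ) (fun i _ => hp i) hp1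
    (fun i _ => hx i)
  simp only [smul_eq_mul, hsum] at jensen jensen_eq
  have hpow : (s ^ q * r * s ^ q) ^ α = r ^ α * s ^ (1 - α) := by
    rw [show s ^ q * r * s ^ q = r * (s ^ q * s ^ q) by ring,
      Real.mul_rpow hr (by positivity), Real.mul_rpow (by positivity) (by positivity),
      ← Real.rpow_mul hs, ← Real.rpow_add_of_nonneg hs (by nlinarith) (by nlinarith), ← hq]
    ring_nf
  rw [hpow] at jensen jensen_eq
  have amgm := Real.geom_mean_le_arith_mean2_weighted hα.le (sub_nonneg.2 hα'.le) hr hs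
    (by ring : α + (1 - α) = 1)
  refine ⟨jensen.trans amgm, fun h => ?_⟩
  have hrs : r = s := (Real.geom_mean_eq_arith_mean2_weighted_iff_of_pos hα (sub_pos.2 hα') hr hs
    (by ring)).1 (le_antisymm amgm (h ▸ jensen))
  refine ⟨hrs, fun i hi => ?_⟩
  rw [jensen_eq.1 (le_antisymm (h ▸ amgm) jensen) i (Finset.mem_univ i) hi, hrs]

theorem sum_normSq_col_eq_one {ι : Type*} [Fintype ι] [DecidableEq ι] {W : Matrix ι ι ℂ}
    (hW : Wᴴ * W = 1) (j : ι) : ∑ i, Complex.normSq (W i j) = 1 := by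
  have h := congrFun (congrFun hW j) j
  simp only [mul_apply, conjTranspose_apply, one_apply_eq, RCLike.star_def,
    ← Complex.normSq_eq_conj_mul_self] at h
  exact_mod_cast h

theorem sum_normSq_row_eq_one {ι : Type*} [Fintype ι] [DecidableEq ι] {W : Matrix ι ι ℂ}
    (hW : W * Wᴴ = 1) (i : ι) : ∑ j, Complex.normSq (W i j) = 1 := by
  have h := congrFun (congrFun hW i) i
  simp only [mul_apply, conjTranspose_apply, one_apply_eq, RCLike.star_def,
    Complex.mul_conj] at h
  exact_mod_cast h

theorem conjTranspose_mul_diagonal_mul_apply {ι : Type*} [Fintype ι] [DecidableEq ι]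
    (W : Matrix ι ι ℂ) (d : ι → ℂ) (k j : ι) :
    (Wᴴ * diagonal d * W) k j = ∑ i, star (W i k) * d i * W i j := by
  simp [mul_apply (M := Wᴴ * diagonal d), mul_diagonal]

/-- The bound on the trace of a power of `σ ^ q * ρ * σ ^ q`, in an eigenbasis of `σ`. -/
theorem sum_rpow_eigenvalues_le {ι : Type*} [Fintype ι] [DecidableEq ι] {α q : ℝ}
    (hα : 0 < α) (hα' : α < 1) (hq : α * (2 * q) = 1 - α) {R W : Matrix ι ι ℂ}
    (hR : R.PosSemidef) (hR1 : R.trace = 1) {s x : ι → ℝ} (hs : ∀ j, 0 ≤ s j)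
    (hs1 : ∑ j, s j = 1) (hx : ∀ i, 0 ≤ x i) (hW : Wᴴ * W = 1) (hW' : W * Wᴴ = 1)
    (h : Wᴴ * diagonal (fun i => (x i : ℂ)) * W =
      diagonal (fun j => ((s j ^ q : ℝ) : ℂ)) * R * diagonal (fun j => ((s j ^ q : ℝ) : ℂ))) :
    ∑ i, x i ^ α ≤ 1 ∧ (∑ i, x i ^ α = 1 ↔ R = diagonal (fun j => (s j : ℂ))) := by
  have hq0 : 0 < q := by
    by_contra! hq0
    nlinarith
  have entry : ∀ k j, ∑ i, star (W i k) * (x i : ℂ) * W i j =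
      ((s k ^ q : ℝ) : ℂ) * R k j * ((s j ^ q : ℝ) : ℂ) := fun k j => by
    rw [← conjTranspose_mul_diagonal_mul_apply W (fun i => (x i : ℂ)), h, mul_diagonal,
      diagonal_mul]
  have hdiag : ∀ j, 0 ≤ (R j j).re ∧ R j j = ((R j j).re : ℂ) := fun j => by
    have h0 := Complex.nonneg_iff.1 (hR.diag_nonneg (i := j))
    exact ⟨h0.1, Complex.ext rfl (by simp [← h0.2])⟩
  have hr1 : ∑ j, (R j j).re = 1 := by
    simpa [trace] using congrArg Complex.re hR1
  have hsum : ∀ j, ∑ i, Complex.normSq (W i j) * x i = s j ^ q * (R j j).re * s j ^ q := by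
    intro j
    have := entry j j
    rw [(hdiag j).2] at this
    have e : ∀ i, star (W i j) * (x i : ℂ) * W i j = ((Complex.normSq (W i j) * x i : ℝ) : ℂ) := by
      intro i
      rw [Complex.ofReal_mul, Complex.normSq_eq_conj_mul_self, RCLike.star_def]
      ring
    simp only [e] at this
    exact_mod_cast this
  have key := fun j => sum_mul_rpow_le hα hα' hq (fun i => Complex.normSq_nonneg (W i j))
    (sum_normSq_col_eq_one hW j) hx (hdiag j).1 (hs j) (hsum j)
  have total : ∑ j, ∑ i, Complex.normSq (W i j) * x i ^ α = ∑ i, x i ^ α := by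
    rw [Finset.sum_comm]
    simp [← Finset.sum_mul, sum_normSq_row_eq_one hW']
  have total' : ∑ j, (α * (R j j).re + (1 - α) * s j) = 1 := by
    rw [Finset.sum_add_distrib, ← Finset.mul_sum, ← Finset.mul_sum, hr1, hs1]
    ring
  refine ⟨?_, fun heq => ?_, fun heq => ?_⟩
  · rw [← total, ← total']
    exact Finset.sum_le_sum fun j _ => (key j).1
  · have hj := fun j => (key j).2 ((Finset.sum_eq_sum_iff_of_le fun j _ => (key j).1).1
      (by rw [total, total', heq]) j (Finset.mem_univ j))
    have hzero : ∀ j, s j = 0 → ∀ k, R k j = 0 := by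
      intro j h0 k
      have hjj : R j j = 0 := by rw [(hdiag j).2, (hj j).1, h0, Complex.ofReal_zero]
      have := (hR.dotProduct_mulVec_zero_iff (Pi.single j 1)).1 (by simp [hjj])
      simpa using congrFun this k
    have hent : ∀ k j, ((s k ^ q : ℝ) : ℂ) * R k j * ((s j ^ q : ℝ) : ℂ) =
        (1 : Matrix ι ι ℂ) k j * ((s j ^ q * s j * s j ^ q : ℝ) : ℂ) := by
      intro k j
      rw [← entry, ← hW, mul_apply, Finset.sum_mul]
      refine Finset.sum_congr rfl fun i _ => ?_
      by_cases h0 : W i j = 0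
      · simp [h0]
      · rw [(hj j).2 i (by simpa using h0), conjTranspose_apply]
        ring
    have hpos : ∀ j, s j ≠ 0 → ((s j ^ q : ℝ) : ℂ) ≠ 0 := fun j h0 => by
      exact_mod_cast (Real.rpow_pos_of_pos (lt_of_le_of_ne (hs j) h0.symm) q).ne'
    ext k j
    by_cases hkj : k = j
    · subst hkj
      rw [diagonal_apply_eq, (hdiag k).2, (hj k).1]
    · rw [diagonal_apply_ne _ hkj]
      by_cases hsj : s j = 0
      · exact hzero j hsj k
      by_cases hsk : s k = 0
      · rw [← hR.1.apply, hzero k hsk j, star_zero]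
      have := hent k j
      rw [one_apply_ne hkj, zero_mul] at this
      simpa [hpos j hsj, hpos k hsk] using this
  · have hWx : diagonal (fun i => (x i : ℂ)) * W =
        W * diagonal (fun j => ((s j ^ q * s j * s j ^ q : ℝ) : ℂ)) := by
      rw [heq, diagonal_mul_diagonal, diagonal_mul_diagonal] at h
      have := congrArg (W * ·) h
      simp only [← mul_assoc, hW', one_mul] at this
      simpa using this
    rw [← total, ← hs1]
    refine Finset.sum_congr rfl fun j _ => ?_
    rw [← one_mul (s j), ← sum_normSq_col_eq_one hW j, Finset.sum_mul]
    refine Finset.sum_congr rfl fun i _ => ?_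
    by_cases h0 : W i j = 0
    · simp [h0]
    have hij := congrFun (congrFun hWx i) j
    rw [diagonal_mul, mul_diagonal, mul_comm] at hij
    have hxi : x i = s j ^ q * s j * s j ^ q := by exact_mod_cast mul_left_cancel₀ h0 hij
    have hxi' : x i = s j ^ (q + 1 + q) := by
      rw [hxi, Real.rpow_add_of_nonneg (hs j) (by linarith) hq0.le,
        Real.rpow_add_of_nonneg (hs j) hq0.le zero_le_one, Real.rpow_one]
    rw [hxi', ← Real.rpow_mul (hs j), show (q + 1 + q) * α = 1 by linarith, Real.rpow_one]

theorem isHermitian_mpow {ι : Type*} [Fintype ι] [DecidableEq ι] (A : Matrix ι ι ℂ) (t : ℝ) :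
    (mpow A t).IsHermitian := by
  unfold mpow
  split_ifs with hA
  · rw [star_eq_conjTranspose]
    exact isHermitian_mul_mul_conjTranspose _
      (isHermitian_diagonal_of_self_adjoint _ (by ext; simp))
  · exact isHermitian_zero

theorem trace_mpow {ι : Type*} [Fintype ι] [DecidableEq ι] {A : Matrix ι ι ℂ}
    (hA : A.IsHermitian) (t : ℝ) : (mpow A t).trace = ((∑ i, hA.eigenvalues i ^ t : ℝ) : ℂ) := by
  rw [mpow, dif_pos hA, trace_mul_cycle, Unitary.coe_star_mul_self, one_mul, trace_diagonal,
    Complex.ofReal_sum]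

theorem eq_eigenvectorUnitary_mul_diagonal_mul {ι : Type*} [Fintype ι] [DecidableEq ι]
    {A : Matrix ι ι ℂ} (hA : A.IsHermitian) :
    A = (hA.eigenvectorUnitary : Matrix ι ι ℂ) * diagonal (fun i => (hA.eigenvalues i : ℂ)) *
      (hA.eigenvectorUnitary : Matrix ι ι ℂ)ᴴ :=
  hA.spectral_theorem

/-- the α-fidelity of density matrices lies in `[0,1]`, with value `1`
if and only if the two states coincide. -/
theorem stmt4 {n : ℕ} (α : ℝ) (hα : 0 < α) (hα' : α < 1)
    (ρ₁ ρ₂ : Matrix (Fin n) (Fin n) ℂ) (hρ₁ : IsDensity ρ₁) (hρ₂ : IsDensity ρ₂) :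
    0 ≤ aFid α ρ₁ ρ₂ ∧ aFid α ρ₁ ρ₂ ≤ 1 ∧ (aFid α ρ₁ ρ₂ = 1 ↔ ρ₁ = ρ₂) := by
  obtain ⟨hp₁, ht₁⟩ := hρ₁
  obtain ⟨hp₂, ht₂⟩ := hρ₂
  unfold aFid
  set q := (1 - α) / (2 * α) with hq_def
  have hq : α * (2 * q) = 1 - α := by
    rw [hq_def]
    field_simp
  set X := mpow ρ₂ q * ρ₁ * mpow ρ₂ q with hX_def
  have hX : X.PosSemidef := by
    have := hp₁.mul_mul_conjTranspose_same (mpow ρ₂ q)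
    rwa [(isHermitian_mpow ρ₂ q).eq] at this
  rw [trace_mpow hX.1, Complex.ofReal_re]
  refine ⟨Finset.sum_nonneg fun i _ => Real.rpow_nonneg (hX.eigenvalues_nonneg i) _, ?_⟩
  set U : Matrix (Fin n) (Fin n) ℂ := (hX.1.eigenvectorUnitary).1
  set V : Matrix (Fin n) (Fin n) ℂ := (hp₂.1.eigenvectorUnitary).1
  have hU' : U * Uᴴ = 1 := Unitary.coe_mul_star_self hX.1.eigenvectorUnitary
  have hV : Vᴴ * V = 1 := Unitary.coe_star_mul_self hp₂.1.eigenvectorUnitary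
  have hV' : V * Vᴴ = 1 := Unitary.coe_mul_star_self hp₂.1.eigenvectorUnitary
  set D : Matrix (Fin n) (Fin n) ℂ := diagonal (fun j => ((hp₂.1.eigenvalues j ^ q : ℝ) : ℂ))
    with hD_def
  have hpow : mpow ρ₂ q = V * D * Vᴴ := by
    rw [mpow, dif_pos hp₂.1]
    rfl
  have hXU : X = U * diagonal (fun i => (hX.1.eigenvalues i : ℂ)) * Uᴴ :=
    eq_eigenvectorUnitary_mul_diagonal_mul hX.1
  have hρV : ρ₂ = V * diagonal (fun i => (hp₂.1.eigenvalues i : ℂ)) * Vᴴ :=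
    eq_eigenvectorUnitary_mul_diagonal_mul hp₂.1
  have hs1 : ∑ j, hp₂.1.eigenvalues j = 1 := by
    have := hp₂.1.trace_eq_sum_eigenvalues
    rw [ht₂] at this
    simpa using (congrArg Complex.re this).symm
  have hW : (Uᴴ * V)ᴴ * (Uᴴ * V) = 1 := by
    rw [conjTranspose_mul, conjTranspose_conjTranspose, mul_assoc, ← mul_assoc U, hU', one_mul, hV]
  have hconj : (Uᴴ * V)ᴴ * diagonal (fun i => (hX.1.eigenvalues i : ℂ)) * (Uᴴ * V) =
      D * (Vᴴ * ρ₁ * V) * D := by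
    calc _ = Vᴴ * (U * diagonal (fun i => (hX.1.eigenvalues i : ℂ)) * Uᴴ) * V := by
          rw [conjTranspose_mul, conjTranspose_conjTranspose]
          simp only [mul_assoc]
      _ = Vᴴ * ((V * D * Vᴴ) * ρ₁ * (V * D * Vᴴ)) * V := by rw [← hXU, hX_def, hpow]
      _ = (Vᴴ * V) * D * (Vᴴ * ρ₁ * V) * D * (Vᴴ * V) := by simp only [mul_assoc]
      _ = _ := by rw [hV, one_mul, mul_one]
  have main := sum_rpow_eigenvalues_le hα hα' hq (hp₁.conjTranspose_mul_mul_same V)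
    (by rw [trace_mul_cycle, hV', one_mul, ht₁]) hp₂.eigenvalues_nonneg hs1
    hX.eigenvalues_nonneg hW (mul_eq_one_comm.1 hW) hconj
  refine ⟨main.1, main.2.trans ⟨fun h => ?_, fun h => ?_⟩⟩
  · rw [hρV, ← h]
    calc ρ₁ = (V * Vᴴ) * ρ₁ * (V * Vᴴ) := by rw [hV', one_mul, mul_one]
      _ = _ := by simp only [mul_assoc]
  · rw [h]
    calc Vᴴ * ρ₂ * V = Vᴴ * (V * diagonal (fun i => (hp₂.1.eigenvalues i : ℂ)) * Vᴴ) * V := by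
          rw [← hρV]
      _ = (Vᴴ * V) * diagonal (fun i => (hp₂.1.eigenvalues i : ℂ)) * (Vᴴ * V) := by
          simp only [mul_assoc]
      _ = _ := by rw [hV, one_mul, mul_one]
end

section
/- For every α ∈ (0,1) and all density matrices ρ₁, ρ₂ on ℂ^n, one has F_α(ρ₁, ρ₂) = 0 if and only if ρ₁ ρ₂ = 0 (i.e. the supports of ρ₁ and ρ₂ are orthogonal). -/
open Matrix
open scoped Kronecker ComplexOrder

section Helpers

variable {ι κ : Type*} [Fintype ι] [DecidableEq ι]

theorem mpow_posSemidef {A : Matrix ι ι ℂ} (hA : A.PosSemidef) (t : ℝ) :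
    (mpow A t).PosSemidef := by
  rw [mpow, dif_pos hA.isHermitian]
  refine PosSemidef.mul_mul_conjTranspose_same (PosSemidef.diagonal fun i => ?_) _
  simpa using Complex.zero_le_real.mpr (Real.rpow_nonneg (hA.eigenvalues_nonneg i) t)

theorem mul_eigenvectorUnitary_diagonal_eq_zero_iff {A : Matrix ι ι ℂ} (hA : A.IsHermitian)
    (X : Matrix κ ι ℂ) (d : ι → ℂ) :
    X * ((hA.eigenvectorUnitary : Matrix ι ι ℂ) * diagonal d *
      star (hA.eigenvectorUnitary : Matrix ι ι ℂ)) = 0 ↔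
      ∀ i j, (X * (hA.eigenvectorUnitary : Matrix ι ι ℂ)) i j = 0 ∨ d j = 0 := by
  have hU : star (hA.eigenvectorUnitary : Matrix ι ι ℂ) * hA.eigenvectorUnitary = 1 :=
    Unitary.coe_star_mul_self _
  have key : X * ((hA.eigenvectorUnitary : Matrix ι ι ℂ) * diagonal d *
      star (hA.eigenvectorUnitary : Matrix ι ι ℂ)) = 0 ↔
      X * (hA.eigenvectorUnitary : Matrix ι ι ℂ) * diagonal d = 0 := by
    constructor
    · intro h
      have := congrArg (· * (hA.eigenvectorUnitary : Matrix ι ι ℂ)) h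
      simpa [Matrix.mul_assoc, hU] using this
    · intro h
      rw [← Matrix.mul_assoc, ← Matrix.mul_assoc, h, Matrix.zero_mul]
  rw [key, ← Matrix.ext_iff]
  simp [mul_diagonal]

theorem mul_mpow_eq_zero_iff {A : Matrix ι ι ℂ} (hA : A.PosSemidef) {t : ℝ} (ht : t ≠ 0)
    (X : Matrix κ ι ℂ) : X * mpow A t = 0 ↔ X * A = 0 := by
  have hspec : A = (hA.isHermitian.eigenvectorUnitary : Matrix ι ι ℂ) *
      diagonal (fun i => (hA.isHermitian.eigenvalues i : ℂ)) *
      star (hA.isHermitian.eigenvectorUnitary : Matrix ι ι ℂ) :=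
    hA.isHermitian.spectral_theorem
  conv_rhs => rw [hspec]
  rw [mpow, dif_pos hA.isHermitian, mul_eigenvectorUnitary_diagonal_eq_zero_iff,
    mul_eigenvectorUnitary_diagonal_eq_zero_iff]
  simp [Real.rpow_eq_zero (hA.eigenvalues_nonneg _) ht]

theorem re_trace_mpow_eq_zero_iff {A : Matrix ι ι ℂ} (hA : A.PosSemidef) {t : ℝ} (ht : t ≠ 0) :
    (mpow A t).trace.re = 0 ↔ A = 0 := by
  have hP := mpow_posSemidef hA t
  have him : (mpow A t).trace.im = 0 := (Complex.nonneg_iff.mp hP.trace_nonneg).2.symm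
  rw [← one_mul A, ← mul_mpow_eq_zero_iff hA ht, one_mul, one_mul, ← hP.trace_eq_zero_iff,
    Complex.ext_iff]
  simp [him]

open scoped MatrixOrder in
theorem Matrix.PosSemidef.conjTranspose_mul_mul_same_eq_zero_iff [Fintype κ] {A : Matrix ι ι ℂ}
    (hA : A.PosSemidef) (S : Matrix ι κ ℂ) : Sᴴ * A * S = 0 ↔ A * S = 0 := by
  refine ⟨fun h => ?_, fun h => by rw [Matrix.mul_assoc, h, Matrix.mul_zero]⟩
  obtain ⟨B, rfl⟩ := CStarAlgebra.nonneg_iff_eq_star_mul_self.mp hA.nonneg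
  rw [star_eq_conjTranspose] at h ⊢
  have hBS : (B * S)ᴴ * (B * S) = 0 := by
    simpa [conjTranspose_mul, Matrix.mul_assoc] using h
  rw [Matrix.mul_assoc, conjTranspose_mul_self_eq_zero.mp hBS, Matrix.mul_zero]

end Helpers

/-- the α-fidelity vanishes exactly when the supports are orthogonal,
i.e. `ρ₁ ρ₂ = 0`. -/
theorem stmt5 {n : ℕ} (α : ℝ) (hα : 0 < α) (hα' : α < 1)
    (ρ₁ ρ₂ : Matrix (Fin n) (Fin n) ℂ) (hρ₁ : IsDensity ρ₁) (hρ₂ : IsDensity ρ₂) :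
    aFid α ρ₁ ρ₂ = 0 ↔ ρ₁ * ρ₂ = 0 := by
  have hs : (1 - α) / (2 * α) ≠ 0 := by
    have : 0 < 1 - α := sub_pos.mpr hα'
    positivity
  have hS : (mpow ρ₂ ((1 - α) / (2 * α)))ᴴ = mpow ρ₂ ((1 - α) / (2 * α)) :=
    (mpow_posSemidef hρ₂.1 _).isHermitian
  have hM := hρ₁.1.conjTranspose_mul_mul_same (mpow ρ₂ ((1 - α) / (2 * α)))
  have hzero := hρ₁.1.conjTranspose_mul_mul_same_eq_zero_iff (mpow ρ₂ ((1 - α) / (2 * α)))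
  rw [hS] at hM hzero
  rw [aFid, re_trace_mpow_eq_zero_iff hM hα.ne', hzero, mul_mpow_eq_zero_iff hρ₂.1 hs]
end
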